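/- arXiv:1706.08037 — 3 statements merged into one kernel-verified Lean document; each statement's English description precedes it below -/
import Mathlib

section
/- Let P ∈ ℝ^{m₁×m₁} and Q ∈ ℝ^{m₂×m₂} be symmetric idempotent, σ² > 0, η² > 0, γ² = η²/σ², and let Ω be a sequence of pairwise distinct indices with the matrices R_N(Ω) and vectors ν_{k,l}(Ω) as defined. Then for every index (k,l) ∈ [m₁]×[m₂], the conditional variance formula satisfies 0 ≤ v_Ω(k,l) ≤ σ² P_{k,k} Q_{l,l} ≤ σ². In particular the quadratic form ν_{k,l}(Ω)ᵀ (R_N(Ω)+γ²I)^{-1} ν_{k,l}(Ω) is nonnegative and bounded above by P_{k,k} Q_{l,l}. -/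
open Matrix

noncomputable section

/-- The design covariance matrix `R_N(Ω)` with entries `P_{i_n,i_{n'}} Q_{j_n,j_{n'}}`. -/
def designR {m₁ m₂ N : ℕ} (P : Matrix (Fin m₁) (Fin m₁) ℝ) (Q : Matrix (Fin m₂) (Fin m₂) ℝ)
    (Ω : Fin N → Fin m₁ × Fin m₂) : Matrix (Fin N) (Fin N) ℝ :=
  Matrix.of fun n n' => P (Ω n).1 (Ω n').1 * Q (Ω n).2 (Ω n').2

/-- The cross-coherence vector `ν_{k,l}(Ω)` with `n`-th entry `P_{k,i_n} Q_{l,j_n}`. -/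
def nuVec {m₁ m₂ N : ℕ} (P : Matrix (Fin m₁) (Fin m₁) ℝ) (Q : Matrix (Fin m₂) (Fin m₂) ℝ)
    (Ω : Fin N → Fin m₁ × Fin m₂) (k : Fin m₁) (l : Fin m₂) : Fin N → ℝ :=
  fun n => P k (Ω n).1 * Q l (Ω n).2

/-- Conditional variance formula `v_Ω(k,l)`. -/
def condVar {m₁ m₂ N : ℕ} (σ2 γ2 : ℝ) (P : Matrix (Fin m₁) (Fin m₁) ℝ)
    (Q : Matrix (Fin m₂) (Fin m₂) ℝ) (Ω : Fin N → Fin m₁ × Fin m₂)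
    (k : Fin m₁) (l : Fin m₂) : ℝ :=
  σ2 * (P k k * Q l l -
    nuVec P Q Ω k l ⬝ᵥ ((designR P Q Ω + γ2 • (1 : Matrix (Fin N) (Fin N) ℝ))⁻¹ *ᵥ nuVec P Q Ω k l))

/-- Conditional covariance formula `c_Ω((i,j),(k,l))`. -/
def condCov {m₁ m₂ N : ℕ} (σ2 γ2 : ℝ) (P : Matrix (Fin m₁) (Fin m₁) ℝ)
    (Q : Matrix (Fin m₂) (Fin m₂) ℝ) (Ω : Fin N → Fin m₁ × Fin m₂)
    (i k : Fin m₁) (j l : Fin m₂) : ℝ :=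
  σ2 * (P i k * Q j l -
    nuVec P Q Ω i j ⬝ᵥ ((designR P Q Ω + γ2 • (1 : Matrix (Fin N) (Fin N) ℝ))⁻¹ *ᵥ nuVec P Q Ω k l))

/-- Observational entropy `H(Ω) = det(σ² R_N(Ω) + η² I)`. -/
def obsEntropy {m₁ m₂ N : ℕ} (σ2 η2 : ℝ) (P : Matrix (Fin m₁) (Fin m₁) ℝ)
    (Q : Matrix (Fin m₂) (Fin m₂) ℝ) (Ω : Fin N → Fin m₁ × Fin m₂) : ℝ :=
  (σ2 • designR P Q Ω + η2 • (1 : Matrix (Fin N) (Fin N) ℝ)).det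

/-- Sequential criterion `H((i,j)|Ω)`. -/
def seqCrit {m₁ m₂ N : ℕ} (γ2 : ℝ) (P : Matrix (Fin m₁) (Fin m₁) ℝ)
    (Q : Matrix (Fin m₂) (Fin m₂) ℝ) (Ω : Fin N → Fin m₁ × Fin m₂)
    (i : Fin m₁) (j : Fin m₂) : ℝ :=
  P i i * Q j j -
    nuVec P Q Ω i j ⬝ᵥ ((designR P Q Ω + γ2 • (1 : Matrix (Fin N) (Fin N) ℝ))⁻¹ *ᵥ nuVec P Q Ω i j)


/-- A diagonal entry of a symmetric idempotent matrix lies in `[0, 1]`. -/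
theorem diag_mem_Icc_of_symm_idem {n : Type*} [Fintype n] {P : Matrix n n ℝ}
    (hsymm : Pᵀ = P) (hidem : P * P = P) (k : n) : P k k ∈ Set.Icc (0 : ℝ) 1 := by
  have hsum : P k k = ∑ j, P k j ^ 2 := by
    conv_lhs => rw [← hidem, Matrix.mul_apply]
    refine Finset.sum_congr rfl fun j _ => ?_
    rw [sq, ← Matrix.transpose_apply P k j, hsymm]
  have hle : P k k ^ 2 ≤ P k k := by
    conv_rhs => rw [hsum]
    exact Finset.single_le_sum (f := fun j => P k j ^ 2) (fun j _ => sq_nonneg _)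
      (Finset.mem_univ k)
  constructor <;> nlinarith

/-- A real symmetric idempotent matrix is positive semidefinite. -/
theorem posSemidef_of_symm_idem {n : Type*} [Fintype n] {P : Matrix n n ℝ}
    (hsymm : Pᵀ = P) (hidem : P * P = P) : P.PosSemidef := by
  have h := Matrix.posSemidef_conjTranspose_mul_self P
  rwa [Matrix.conjTranspose_eq_transpose_of_trivial, hsymm, hidem] at h

/-- The regularized Schur complement of a principal block of a positive semidefinite matrix is
nonnegative. -/
theorem dotProduct_inv_mulVec_le_of_posSemidef {ι n : Type*} [Fintype n] [DecidableEq n]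
    {M : Matrix ι ι ℝ} (hM : M.PosSemidef) (f : n → ι) (c : ι) {γ : ℝ} (hγ : 0 < γ) :
    (fun i => M c (f i)) ⬝ᵥ ((M.submatrix f f + γ • (1 : Matrix n n ℝ))⁻¹ *ᵥ
      fun i => M c (f i)) ≤ M c c := by
  set ν : n → ℝ := fun i => M c (f i) with hν
  set R := M.submatrix f f with hR
  set A := R + γ • (1 : Matrix n n ℝ) with hA
  have hAdef : A.PosDef := Matrix.PosDef.posSemidef_add (hM.submatrix f) (Matrix.PosDef.one.smul hγ)
  set w := A⁻¹ *ᵥ ν with hw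
  have hAw : R *ᵥ w + γ • w = ν := by
    have h : A *ᵥ w = ν := by
      rw [hw, Matrix.mulVec_mulVec, Matrix.mul_nonsing_inv _ hAdef.det_pos.ne'.isUnit,
        Matrix.one_mulVec]
    rwa [hA, Matrix.add_mulVec, Matrix.smul_mulVec, Matrix.one_mulVec] at h
  have hsymm (i : n) : M (f i) c = ν i := by simpa using hM.1.apply c (f i)
  have hquad := (hM.submatrix (Sum.elim f fun _ : Unit => c)).dotProduct_mulVec_nonneg
    (Sum.elim w fun _ => -1)
  have hexpand : 0 ≤ w ⬝ᵥ (R *ᵥ w) - 2 * (ν ⬝ᵥ w) + M c c := by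
    refine hquad.trans_eq ?_
    simp only [dotProduct, Matrix.mulVec, Fintype.sum_sum_type, hsymm, hR, mul_add,
      Finset.sum_add_distrib, Matrix.submatrix_apply, Sum.elim_inl, Sum.elim_inr, Pi.star_apply,
      star_trivial, Finset.univ_unique, Finset.sum_singleton, mul_neg, mul_one,
      Finset.sum_neg_distrib, neg_mul, one_mul, mul_comm (w _) (ν _)]
    ring
  have hself : w ⬝ᵥ (R *ᵥ w) + γ * (w ⬝ᵥ w) = ν ⬝ᵥ w := by
    rw [dotProduct_comm ν w, ← hAw, dotProduct_add, dotProduct_smul, smul_eq_mul]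
  have hnn : 0 ≤ w ⬝ᵥ w := Finset.sum_nonneg fun i _ => mul_self_nonneg (w i)
  nlinarith [mul_nonneg hγ.le hnn]

/-- For symmetric idempotent `P`, `Q`, the conditional variance formula
satisfies `0 ≤ v_Ω(k,l) ≤ σ² P_{k,k} Q_{l,l} ≤ σ²`, and the quadratic form
`ν_{k,l}ᵀ (R_N(Ω)+γ²I)⁻¹ ν_{k,l}` lies in `[0, P_{k,k} Q_{l,l}]`. -/
theorem condVar_bounds {m₁ m₂ N : ℕ}
    (P : Matrix (Fin m₁) (Fin m₁) ℝ) (Q : Matrix (Fin m₂) (Fin m₂) ℝ)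
    (hPsymm : Pᵀ = P) (hPidem : P * P = P)
    (hQsymm : Qᵀ = Q) (hQidem : Q * Q = Q)
    (σ2 η2 γ2 : ℝ) (hσ2 : 0 < σ2) (hη2 : 0 < η2) (hγ2 : γ2 = η2 / σ2)
    (Ω : Fin N → Fin m₁ × Fin m₂) (hΩ : Function.Injective Ω)
    (k : Fin m₁) (l : Fin m₂) :
    0 ≤ condVar σ2 γ2 P Q Ω k l ∧
    condVar σ2 γ2 P Q Ω k l ≤ σ2 * (P k k * Q l l) ∧
    σ2 * (P k k * Q l l) ≤ σ2 ∧
    0 ≤ nuVec P Q Ω k l ⬝ᵥ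
        ((designR P Q Ω + γ2 • (1 : Matrix (Fin N) (Fin N) ℝ))⁻¹ *ᵥ nuVec P Q Ω k l) ∧
    nuVec P Q Ω k l ⬝ᵥ
        ((designR P Q Ω + γ2 • (1 : Matrix (Fin N) (Fin N) ℝ))⁻¹ *ᵥ nuVec P Q Ω k l) ≤
      P k k * Q l l := by
  have hγ : 0 < γ2 := hγ2 ▸ div_pos hη2 hσ2
  have hK := (posSemidef_of_symm_idem hPsymm hPidem).kronecker
    (posSemidef_of_symm_idem hQsymm hQidem)
  have hupper : nuVec P Q Ω k l ⬝ᵥ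
      ((designR P Q Ω + γ2 • (1 : Matrix (Fin N) (Fin N) ℝ))⁻¹ *ᵥ nuVec P Q Ω k l) ≤
      P k k * Q l l :=
    dotProduct_inv_mulVec_le_of_posSemidef hK Ω (k, l) hγ
  have hR : (designR P Q Ω).PosSemidef := hK.submatrix Ω
  have hlower : 0 ≤ nuVec P Q Ω k l ⬝ᵥ
      ((designR P Q Ω + γ2 • (1 : Matrix (Fin N) (Fin N) ℝ))⁻¹ *ᵥ nuVec P Q Ω k l) := by
    simpa using (Matrix.PosDef.posSemidef_add hR
      (Matrix.PosDef.one.smul hγ)).inv.posSemidef.dotProduct_mulVec_nonneg (nuVec P Q Ω k l)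
  have hP := diag_mem_Icc_of_symm_idem hPsymm hPidem k
  have hQ := diag_mem_Icc_of_symm_idem hQsymm hQidem l
  refine ⟨mul_nonneg hσ2.le (sub_nonneg.2 hupper),
    mul_le_mul_of_nonneg_left (sub_le_self _ hlower) hσ2.le,
    mul_le_of_le_one_right hσ2.le (mul_le_one₀ hP.2 hQ.1 hQ.2), hlower, hupper⟩

end
end

section
/- (Variance reduction.) Let P ∈ ℝ^{m₁×m₁} and Q ∈ ℝ^{m₂×m₂} be symmetric idempotent, σ² > 0, η² > 0, γ² = η²/σ². Let Ω be a sequence of N pairwise distinct indices, let (i,j) ∉ Ω, and let Ω ∪ (i,j) denote the length-(N+1) sequence obtained by appending (i,j). Then for every index (k,l) ∈ [m₁]×[m₂], the conditional variance formulas satisfy the exact decomposition v_{Ω∪(i,j)}(k,l) = v_Ω(k,l) − c_Ω((i,j),(k,l))² / ( v_Ω(i,j) + η² ), where the denominator v_Ω(i,j) + η² is strictly positive. -/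
open Matrix

noncomputable section

open scoped Kronecker in
lemma designR_posSemidef {m₁ m₂ N : ℕ} {P : Matrix (Fin m₁) (Fin m₁) ℝ}
    {Q : Matrix (Fin m₂) (Fin m₂) ℝ} (hP : P.PosSemidef) (hQ : Q.PosSemidef)
    (Ω : Fin N → Fin m₁ × Fin m₂) : (designR P Q Ω).PosSemidef :=
  (hP.kronecker hQ).submatrix Ω

lemma posSemidef_of_transpose_eq_of_mul_self {m : Type*} [Fintype m] {P : Matrix m m ℝ}
    (hsymm : Pᵀ = P) (hidem : P * P = P) : P.PosSemidef := by
  have h := posSemidef_conjTranspose_mul_self P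
  rwa [conjTranspose_eq_transpose_of_trivial, hsymm, hidem] at h

/-- `M` is the block matrix with blocks `A`, the vector `b` as last row and column, and corner `a`. -/
def IsBordered {N : ℕ} (M : Matrix (Fin (N + 1)) (Fin (N + 1)) ℝ)
    (A : Matrix (Fin N) (Fin N) ℝ) (b : Fin N → ℝ) (a : ℝ) : Prop :=
  (∀ n n', M n.castSucc n'.castSucc = A n n') ∧ (∀ n, M n.castSucc (Fin.last N) = b n) ∧
    (∀ n, M (Fin.last N) n.castSucc = b n) ∧ M (Fin.last N) (Fin.last N) = a

lemma snoc_dotProduct_snoc {N : ℕ} (u v : Fin N → ℝ) (s t : ℝ) :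
    (Fin.snoc u s : Fin (N + 1) → ℝ) ⬝ᵥ (Fin.snoc v t : Fin (N + 1) → ℝ) = u ⬝ᵥ v + s * t := by
  simp [dotProduct, Fin.sum_univ_castSucc]

lemma IsBordered.mulVec_snoc {N : ℕ} {M : Matrix (Fin (N + 1)) (Fin (N + 1)) ℝ}
    {A : Matrix (Fin N) (Fin N) ℝ} {b : Fin N → ℝ} {a : ℝ} (h : IsBordered M A b a)
    (u : Fin N → ℝ) (t : ℝ) :
    M *ᵥ (Fin.snoc u t : Fin (N + 1) → ℝ) = Fin.snoc (A *ᵥ u + t • b) (b ⬝ᵥ u + a * t) := by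
  obtain ⟨h₁, h₂, h₃, h₄⟩ := h
  funext n
  refine Fin.lastCases ?_ (fun n => ?_) n
  · simp [mulVec, dotProduct, Fin.sum_univ_castSucc, h₃, h₄]
  · simp [mulVec, dotProduct, Fin.sum_univ_castSucc, h₁, h₂, mul_comm t]

/-- The Schur complement of a positive definite block in a positive definite bordered matrix is
positive. -/
lemma IsBordered.schur_pos {N : ℕ} {M : Matrix (Fin (N + 1)) (Fin (N + 1)) ℝ}
    {A : Matrix (Fin N) (Fin N) ℝ} {b : Fin N → ℝ} {a : ℝ} (h : IsBordered M A b a)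
    (hM : M.PosDef) (hA : A.PosDef) : 0 < a - b ⬝ᵥ (A⁻¹ *ᵥ b) := by
  have hdet : IsUnit A.det := (isUnit_iff_isUnit_det A).1 hA.isUnit
  set z : Fin (N + 1) → ℝ := Fin.snoc (-(A⁻¹ *ᵥ b)) 1 with hz
  have hz0 : z ≠ 0 := fun h0 => by simpa [hz] using congrFun h0 (Fin.last N)
  have hpos := hM.dotProduct_mulVec_pos hz0
  rw [star_trivial, hz, h.mulVec_snoc, snoc_dotProduct_snoc, mulVec_neg, mulVec_mulVec,
    mul_nonsing_inv A hdet] at hpos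
  simp at hpos
  linarith

/-- The quadratic form of the inverse of a bordered matrix, in terms of the inverse of the
bordered block. -/
lemma IsBordered.dotProduct_inv_mulVec {N : ℕ} {M : Matrix (Fin (N + 1)) (Fin (N + 1)) ℝ}
    {A : Matrix (Fin N) (Fin N) ℝ} {b : Fin N → ℝ} {a : ℝ} (h : IsBordered M A b a)
    (hM : M.PosDef) (hA : A.PosDef) (v : Fin N → ℝ) (d : ℝ) :
    (Fin.snoc v d : Fin (N + 1) → ℝ) ⬝ᵥ (M⁻¹ *ᵥ (Fin.snoc v d : Fin (N + 1) → ℝ)) =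
      v ⬝ᵥ (A⁻¹ *ᵥ v) + (d - b ⬝ᵥ (A⁻¹ *ᵥ v)) ^ 2 / (a - b ⬝ᵥ (A⁻¹ *ᵥ b)) := by
  have hs := h.schur_pos hM hA
  have hAdet : IsUnit A.det := (isUnit_iff_isUnit_det A).1 hA.isUnit
  have hMdet : IsUnit M.det := (isUnit_iff_isUnit_det M).1 hM.isUnit
  have hsymm : v ⬝ᵥ (A⁻¹ *ᵥ b) = b ⬝ᵥ (A⁻¹ *ᵥ v) := by
    have hT : (A⁻¹)ᵀ = A⁻¹ := by
      simpa [conjTranspose_eq_transpose_of_trivial] using hA.inv.isHermitian.eq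
    rw [dotProduct_mulVec, ← mulVec_transpose, hT, dotProduct_comm]
  set s := a - b ⬝ᵥ (A⁻¹ *ᵥ b) with hs_def
  set t := (d - b ⬝ᵥ (A⁻¹ *ᵥ v)) / s with ht
  have hts : t * s = d - b ⬝ᵥ (A⁻¹ *ᵥ v) := div_mul_cancel₀ _ hs.ne'
  have hsol : M *ᵥ (Fin.snoc (A⁻¹ *ᵥ v - t • (A⁻¹ *ᵥ b)) t : Fin (N + 1) → ℝ) =
      Fin.snoc v d := by
    rw [h.mulVec_snoc]
    congr 1
    · rw [mulVec_sub, mulVec_smul, mulVec_mulVec, mulVec_mulVec, mul_nonsing_inv A hAdet]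
      simp
    · rw [dotProduct_sub, dotProduct_smul, smul_eq_mul]
      rw [hs_def] at hts
      linarith
  have hinv : M⁻¹ *ᵥ (Fin.snoc v d : Fin (N + 1) → ℝ) =
      Fin.snoc (A⁻¹ *ᵥ v - t • (A⁻¹ *ᵥ b)) t := by
    rw [← hsol, mulVec_mulVec, nonsing_inv_mul M hMdet, one_mulVec]
  rw [hinv, snoc_dotProduct_snoc, dotProduct_sub, dotProduct_smul, smul_eq_mul, hsymm, ht]
  ring

lemma nuVec_snoc {m₁ m₂ N : ℕ} (P : Matrix (Fin m₁) (Fin m₁) ℝ)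
    (Q : Matrix (Fin m₂) (Fin m₂) ℝ) (Ω : Fin N → Fin m₁ × Fin m₂) (p : Fin m₁ × Fin m₂)
    (k : Fin m₁) (l : Fin m₂) :
    nuVec P Q (Fin.snoc Ω p : Fin (N + 1) → Fin m₁ × Fin m₂) k l =
      Fin.snoc (nuVec P Q Ω k l) (P k p.1 * Q l p.2) := by
  funext n
  refine Fin.lastCases ?_ (fun n => ?_) n <;> simp [nuVec]

lemma isBordered_designR_snoc {m₁ m₂ N : ℕ} {P : Matrix (Fin m₁) (Fin m₁) ℝ}
    {Q : Matrix (Fin m₂) (Fin m₂) ℝ} (hP : P.IsSymm) (hQ : Q.IsSymm)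
    (Ω : Fin N → Fin m₁ × Fin m₂) (i : Fin m₁) (j : Fin m₂) (c : ℝ) :
    IsBordered
      (designR P Q (Fin.snoc Ω (i, j) : Fin (N + 1) → Fin m₁ × Fin m₂) +
        c • (1 : Matrix (Fin (N + 1)) (Fin (N + 1)) ℝ))
      (designR P Q Ω + c • (1 : Matrix (Fin N) (Fin N) ℝ)) (nuVec P Q Ω i j)
      (P i i * Q j j + c) := by
  refine ⟨fun n n' => ?_, fun n => ?_, fun n => ?_, ?_⟩
  · simp [designR, Matrix.one_apply]
  · simp [designR, nuVec, Fin.castSucc_ne_last, hP.apply i, hQ.apply j]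
  · simp [designR, nuVec, (Fin.castSucc_ne_last _).symm]
  · simp [designR]

/-- **Variance reduction, Theorem 1.** Appending one new observed index
`(i,j)` to `Ω`, the conditional variance of any entry `(k,l)` decomposes exactly as
`v_{Ω∪(i,j)}(k,l) = v_Ω(k,l) − c_Ω((i,j),(k,l))² / (v_Ω(i,j) + η²)`, with
strictly positive denominator. -/
theorem condVar_variance_reduction {m₁ m₂ N : ℕ}
    (P : Matrix (Fin m₁) (Fin m₁) ℝ) (Q : Matrix (Fin m₂) (Fin m₂) ℝ)
    (hPsymm : Pᵀ = P) (hPidem : P * P = P)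
    (hQsymm : Qᵀ = Q) (hQidem : Q * Q = Q)
    (σ2 η2 γ2 : ℝ) (hσ2 : 0 < σ2) (hη2 : 0 < η2) (hγ2 : γ2 = η2 / σ2)
    (Ω : Fin N → Fin m₁ × Fin m₂) (hΩ : Function.Injective Ω)
    (i : Fin m₁) (j : Fin m₂) (hij : ∀ n, Ω n ≠ (i, j))
    (k : Fin m₁) (l : Fin m₂) :
    0 < condVar σ2 γ2 P Q Ω i j + η2 ∧
    condVar σ2 γ2 P Q (Fin.snoc Ω (i, j)) k l =
      condVar σ2 γ2 P Q Ω k l -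
        (condCov σ2 γ2 P Q Ω i k j l) ^ 2 / (condVar σ2 γ2 P Q Ω i j + η2) := by
  have hP := posSemidef_of_transpose_eq_of_mul_self hPsymm hPidem
  have hQ := posSemidef_of_transpose_eq_of_mul_self hQsymm hQidem
  have hγ : 0 < γ2 := hγ2 ▸ div_pos hη2 hσ2
  have hη : η2 = σ2 * γ2 := by rw [hγ2]; field_simp
  have hpos {n : ℕ} (Θ : Fin n → Fin m₁ × Fin m₂) :
      (designR P Q Θ + γ2 • (1 : Matrix (Fin n) (Fin n) ℝ)).PosDef :=
    PosDef.posSemidef_add (designR_posSemidef hP hQ Θ) (PosDef.one.smul hγ)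
  have hB := isBordered_designR_snoc hPsymm hQsymm Ω i j γ2
  have hs := hB.schur_pos (hpos _) (hpos Ω)
  have hden : condVar σ2 γ2 P Q Ω i j + η2 = σ2 * (P i i * Q j j + γ2 - nuVec P Q Ω i j ⬝ᵥ
      ((designR P Q Ω + γ2 • (1 : Matrix (Fin N) (Fin N) ℝ))⁻¹ *ᵥ nuVec P Q Ω i j)) := by
    rw [condVar, hη]
    ring
  refine ⟨hden ▸ mul_pos hσ2 hs, ?_⟩
  rw [hden]
  unfold condVar condCov
  rw [nuVec_snoc, hB.dotProduct_inv_mulVec (hpos _) (hpos Ω),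
    IsSymm.apply hPsymm i k, IsSymm.apply hQsymm j l]
  field_simp
  ring

end
end

section
/- (Equivalence of balanced designs, Proposition 2.) Let m ≥ 1, R < m, σ² > 0, η² > 0. Fix U₀ ∈ ℝ^{m×R} with U₀ᵀU₀ = I_R, and let ν be the Haar probability measure on the orthogonal group O(m) of real m×m orthogonal matrices. Let g and h be independent O(m)-valued random elements each distributed according to ν, and define the random projections P = g (U₀U₀ᵀ) gᵀ and Q = h (U₀U₀ᵀ) hᵀ (so that the ranges of P and Q are independent uniformly distributed R-planes in the Grassmann manifold). For a permutation π of [m], let H(Ω_π) := det( σ² R(P,Q,π) + η² I ), where [R(P,Q,π)]_{i,i'} = P_{i,i'} Q_{π(i),π(i')}. Then for any two permutations π₁, π₂ of [m], E[ H(Ω_{π₁}) ] = E[ H(Ω_{π₂}) ]. -/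
open Matrix MeasureTheory

noncomputable section

/-- `Matrix (Fin m) (Fin n) ℝ` carries the (Borel) product measurable structure of
`Fin m → Fin n → ℝ`. -/
instance matrixMeasurableSpace {m n : ℕ} : MeasurableSpace (Matrix (Fin m) (Fin n) ℝ) :=
  (inferInstance : MeasurableSpace (Fin m → Fin n → ℝ))

/-- The design matrix of the balanced design `Ω_π = ((1,π(1)),…,(m,π(m)))`:
`[R(P,Q,π)]_{i,i'} = P_{i,i'} Q_{π(i),π(i')}`. -/
def balancedR {m : ℕ} (P Q : Matrix (Fin m) (Fin m) ℝ) (π : Equiv.Perm (Fin m)) :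
    Matrix (Fin m) (Fin m) ℝ :=
  Matrix.of fun i i' => P i i' * Q (π i) (π i')

/-- Reindexing the rows of a square matrix by a permutation, as a measurable equivalence. -/
def rowPermEquiv {m n : ℕ} (σ : Equiv.Perm (Fin m)) :
    Matrix (Fin m) (Fin n) ℝ ≃ᵐ Matrix (Fin m) (Fin n) ℝ where
  toFun g := g.submatrix σ id
  invFun g := g.submatrix σ.symm id
  left_inv g := by ext; simp
  right_inv g := by ext; simp
  measurable_toFun := measurable_pi_iff.2 fun i => measurable_pi_apply (σ i)
  measurable_invFun := measurable_pi_iff.2 fun i => measurable_pi_apply (σ.symm i)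

/-- A measure invariant under left translation by orthogonal matrices is invariant under
permutations of the rows. -/
theorem measurePreserving_rowPermEquiv {m n : ℕ} {ν : Measure (Matrix (Fin m) (Fin n) ℝ)}
    (hν : ∀ S : Matrix (Fin m) (Fin m) ℝ, Sᵀ * S = 1 → Measure.map (fun g => S * g) ν = ν)
    (σ : Equiv.Perm (Fin m)) : MeasurePreserving (rowPermEquiv (n := n) σ) ν ν := by
  refine ⟨(rowPermEquiv σ).measurable, ?_⟩
  have hS : ((1 : Matrix (Fin m) (Fin m) ℝ).submatrix σ id)ᵀ *
      (1 : Matrix (Fin m) (Fin m) ℝ).submatrix σ id = 1 := by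
    rw [transpose_submatrix, submatrix_mul_equiv]
    simp
  have hmul : (fun g : Matrix (Fin m) (Fin n) ℝ =>
      (1 : Matrix (Fin m) (Fin m) ℝ).submatrix σ id * g) = rowPermEquiv σ := by
    funext g
    ext i j
    change _ = g (σ i) j
    simp [Matrix.mul_apply, Matrix.one_apply]
  rw [← hmul]
  exact hν _ hS

theorem balancedR_submatrix {m : ℕ} (P Q : Matrix (Fin m) (Fin m) ℝ)
    (σ π : Equiv.Perm (Fin m)) :
    balancedR P (Q.submatrix σ σ) π = balancedR P Q (σ * π) := rfl

/-- **Equivalence of balanced designs, Proposition 2.** Let `ν` be the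
Haar probability measure on the orthogonal group `O(m)`, realized as a probability
measure on `m × m` real matrices which is concentrated on orthogonal matrices and is
invariant under left and right translation by every orthogonal matrix. Let `g`, `h` be
independent, each distributed as `ν` (so the pair has law `ν.prod ν`), and set
`P = g (U₀U₀ᵀ) gᵀ`, `Q = h (U₀U₀ᵀ) hᵀ` — independent uniformly distributed random
`R`-dimensional projections. Then for any two permutations `π₁, π₂` of `[m]`, the
expected observational entropies of the corresponding balanced designs agree:
`E[H(Ω_{π₁})] = E[H(Ω_{π₂})]`. -/
theorem balanced_designs_equal_expected_entropy {m R : ℕ} (hm : 1 ≤ m) (hR : R < m)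
    (σ2 η2 : ℝ) (hσ2 : 0 < σ2) (hη2 : 0 < η2)
    (U₀ : Matrix (Fin m) (Fin R) ℝ) (hU₀ : U₀ᵀ * U₀ = 1)
    (ν : Measure (Matrix (Fin m) (Fin m) ℝ)) [IsProbabilityMeasure ν]
    (horth : ∀ᵐ g ∂ν, gᵀ * g = 1)
    (hinv_right : ∀ S : Matrix (Fin m) (Fin m) ℝ, Sᵀ * S = 1 →
      Measure.map (fun g => g * S) ν = ν)
    (hinv_left : ∀ S : Matrix (Fin m) (Fin m) ℝ, Sᵀ * S = 1 →
      Measure.map (fun g => S * g) ν = ν)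
    (π₁ π₂ : Equiv.Perm (Fin m)) :
    (∫ p : Matrix (Fin m) (Fin m) ℝ × Matrix (Fin m) (Fin m) ℝ,
        (σ2 • balancedR (p.1 * (U₀ * U₀ᵀ) * p.1ᵀ) (p.2 * (U₀ * U₀ᵀ) * p.2ᵀ) π₁ +
          η2 • (1 : Matrix (Fin m) (Fin m) ℝ)).det ∂(ν.prod ν)) =
    (∫ p : Matrix (Fin m) (Fin m) ℝ × Matrix (Fin m) (Fin m) ℝ,
        (σ2 • balancedR (p.1 * (U₀ * U₀ᵀ) * p.1ᵀ) (p.2 * (U₀ * U₀ᵀ) * p.2ᵀ) π₂ +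
          η2 • (1 : Matrix (Fin m) (Fin m) ℝ)).det ∂(ν.prod ν)) := by
  have h := (MeasurePreserving.id ν).prod
    (measurePreserving_rowPermEquiv hinv_left (π₂ * π₁⁻¹))
  rw [← h.integral_comp
    ((MeasurableEquiv.refl _).prodCongr (rowPermEquiv (π₂ * π₁⁻¹))).measurableEmbedding]
  refine integral_congr_ae (ae_of_all _ fun p => ?_)
  have hconj : rowPermEquiv (π₂ * π₁⁻¹) p.2 * (U₀ * U₀ᵀ) * (rowPermEquiv (π₂ * π₁⁻¹) p.2)ᵀ =
      (p.2 * (U₀ * U₀ᵀ) * p.2ᵀ).submatrix (π₂ * π₁⁻¹) (π₂ * π₁⁻¹) := rfl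
  simp only [Prod.map_fst, Prod.map_snd, id, hconj, balancedR_submatrix, inv_mul_cancel_right]

end
end
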